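/- (Symmetrization lemma of Vapnik and Chervonenkis.) Let F be a countable class of classifiers and let (X_1, Y_1), …, (X_n, Y_n), (X'_1, Y'_1), …, (X'_n, Y'_n) be 2n points drawn i.i.d. from P. Let R_emp(f) denote the empirical risk of f on the first n points and R'_emp(f) the empirical risk of f on the second n points (the ghost sample). Then for every ε > 0 with nε² ≥ 2, Pr(sup_{f ∈ F} |R(f) − R_emp(f)| > ε) ≤ 2·Pr(sup_{f ∈ F} |R_emp(f) − R'_emp(f)| > ε/2). -/

import Mathlib

open MeasureTheory

/-- The risk of a classifier under the 0-1 loss. Labels `{−1,+1}` are encoded as `Bool`. -/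
noncomputable def risk {X : Type*} [MeasurableSpace X] (P : Measure (X × Bool))
    (f : X → Bool) : ℝ :=
  (P {p | f p.1 ≠ p.2}).toReal

/-- The empirical risk of a classifier on a sample of `n` labeled points. -/
noncomputable def empRisk {X : Type*} {n : ℕ} (f : X → Bool) (s : Fin n → X × Bool) : ℝ :=
  ((Finset.univ.filter fun i => f (s i).1 ≠ (s i).2).card : ℝ) / n

section Symmetrization

variable {X : Type*} {n : ℕ}

/-- The 0-1 loss of a classifier at a labeled point. -/
noncomputable def zeroOneLoss (f : X → Bool) (p : X × Bool) : ℝ :=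
  if f p.1 ≠ p.2 then 1 else 0

lemma zeroOneLoss_mem_Icc (f : X → Bool) (p : X × Bool) : zeroOneLoss f p ∈ Set.Icc (0 : ℝ) 1 := by
  unfold zeroOneLoss
  split_ifs <;> simp

lemma empRisk_eq_sum_zeroOneLoss (f : X → Bool) (s : Fin n → X × Bool) :
    empRisk f s = (n : ℝ)⁻¹ * ∑ i, zeroOneLoss f (s i) := by
  simp only [empRisk, zeroOneLoss, Finset.sum_boole]
  ring

lemma empRisk_mem_Icc (f : X → Bool) (s : Fin n → X × Bool) :
    empRisk f s ∈ Set.Icc (0 : ℝ) 1 := by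
  refine ⟨by unfold empRisk; positivity, div_le_one_of_le₀ ?_ n.cast_nonneg⟩
  exact_mod_cast (Finset.card_filter_le _ _).trans_eq (Finset.card_fin n)

lemma abs_empRisk_sub_empRisk_le_one (f : X → Bool) (s t : Fin n → X × Bool) :
    |empRisk f s - empRisk f t| ≤ 1 := by
  obtain ⟨h₀, h₁⟩ := empRisk_mem_Icc f s
  obtain ⟨h₂, h₃⟩ := empRisk_mem_Icc f t
  exact abs_le.2 ⟨by linarith, by linarith⟩

variable [MeasurableSpace X]

lemma measurableSet_misclassified {f : X → Bool} (hf : Measurable f) :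
    MeasurableSet {p : X × Bool | f p.1 ≠ p.2} :=
  (measurableSet_eq_fun (hf.comp measurable_fst) measurable_snd).compl

lemma measurable_zeroOneLoss {f : X → Bool} (hf : Measurable f) : Measurable (zeroOneLoss f) :=
  Measurable.ite (measurableSet_misclassified hf) measurable_const measurable_const

lemma measurable_empRisk {f : X → Bool} (hf : Measurable f) :
    Measurable (empRisk f : (Fin n → X × Bool) → ℝ) := by
  simp only [funext (empRisk_eq_sum_zeroOneLoss f)]
  have := measurable_zeroOneLoss hf
  fun_prop

variable (P : Measure (X × Bool))

lemma integral_zeroOneLoss {f : X → Bool} (hf : Measurable f) :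
    ∫ p, zeroOneLoss f p ∂P = risk P f := by
  have h : zeroOneLoss f = {p : X × Bool | f p.1 ≠ p.2}.indicator 1 := by
    ext p
    simp [zeroOneLoss, Set.indicator_apply]
  rw [h, integral_indicator_one (measurableSet_misclassified hf)]
  rfl

variable [IsProbabilityMeasure P]

lemma memLp_zeroOneLoss {f : X → Bool} (hf : Measurable f) (q : ENNReal) :
    MemLp (zeroOneLoss f) q P :=
  MemLp.of_bound (measurable_zeroOneLoss hf).aestronglyMeasurable 1 <| .of_forall fun p => by
    obtain ⟨h₀, h₁⟩ := zeroOneLoss_mem_Icc f p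
    rwa [Real.norm_of_nonneg h₀]

lemma integral_empRisk {f : X → Bool} (hf : Measurable f) (hn : n ≠ 0) :
    ∫ s, empRisk f s ∂(Measure.pi fun _ : Fin n => P) = risk P f := by
  simp only [empRisk_eq_sum_zeroOneLoss]
  rw [integral_const_mul, integral_finsetSum]
  · simp_rw [integral_comp_eval (μ := fun _ : Fin n => P)
      (measurable_zeroOneLoss hf).aestronglyMeasurable, integral_zeroOneLoss P hf]
    simp [hn]
  · exact fun i _ => ((memLp_zeroOneLoss P hf 1).comp_measurePreserving
      (measurePreserving_eval (fun _ : Fin n => P) i)).integrable le_rfl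

lemma memLp_empRisk {f : X → Bool} (hf : Measurable f) (q : ENNReal) :
    MemLp (empRisk f) q (Measure.pi fun _ : Fin n => P) :=
  MemLp.of_bound (measurable_empRisk hf).aestronglyMeasurable 1 <| .of_forall fun s => by
    obtain ⟨h₀, h₁⟩ := empRisk_mem_Icc f s
    rwa [Real.norm_of_nonneg h₀]

lemma variance_empRisk_le {f : X → Bool} (hf : Measurable f) (hn : n ≠ 0) :
    ProbabilityTheory.variance (empRisk f) (Measure.pi fun _ : Fin n => P) ≤ 1 / (4 * n) := by
  have hn' : (0 : ℝ) < n := by positivity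
  have h : ProbabilityTheory.variance (zeroOneLoss f) P ≤ 1 / 4 :=
    (ProbabilityTheory.variance_le_sq_of_bounded (.of_forall (zeroOneLoss_mem_Icc f))
      (measurable_zeroOneLoss hf).aemeasurable).trans_eq (by norm_num)
  have hsum := ProbabilityTheory.variance_sum_pi (μ := fun _ : Fin n => P)
    fun _ => memLp_zeroOneLoss P hf 2
  have heq : (empRisk f : (Fin n → X × Bool) → ℝ) =
      fun s => (n : ℝ)⁻¹ * (∑ i, fun s : Fin n → X × Bool => zeroOneLoss f (s i)) s := by
    ext s
    simp [empRisk_eq_sum_zeroOneLoss]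
  rw [heq, ProbabilityTheory.variance_const_mul, hsum, Finset.sum_const, Finset.card_fin,
    nsmul_eq_mul]
  calc (n : ℝ)⁻¹ ^ 2 * ((n : ℝ) * ProbabilityTheory.variance (zeroOneLoss f) P)
      ≤ (n : ℝ)⁻¹ ^ 2 * ((n : ℝ) * (1 / 4)) := by gcongr
    _ = 1 / (4 * (n : ℝ)) := by field_simp

/-- By Chebyshev's inequality the empirical risk is within `ε / 2` of the risk with probability
at least one half, as soon as `n ε² ≥ 2`. -/
lemma one_half_le_measure_abs_risk_sub_empRisk_lt {f : X → Bool} (hf : Measurable f) {ε : ℝ}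
    (hε : 0 < ε) (hnε : 2 ≤ n * ε ^ 2) :
    (2⁻¹ : ENNReal) ≤
      (Measure.pi fun _ : Fin n => P) {s | |risk P f - empRisk f s| < ε / 2} := by
  have hn : n ≠ 0 := by
    rintro rfl
    norm_num at hnε
  have hn' : (0 : ℝ) < n := by positivity
  have hmeas : MeasurableSet {s : Fin n → X × Bool | ε / 2 ≤ |empRisk f s - risk P f|} :=
    measurableSet_le measurable_const ((measurable_empRisk hf).sub_const _).abs
  have hcheb : (Measure.pi fun _ : Fin n => P) {s | ε / 2 ≤ |empRisk f s - risk P f|} ≤ 2⁻¹ := by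
    have h := ProbabilityTheory.meas_ge_le_variance_div_sq
      (memLp_empRisk (n := n) P hf 2) (half_pos hε)
    rw [integral_empRisk P hf hn] at h
    have hreal : ProbabilityTheory.variance (empRisk f) (Measure.pi fun _ : Fin n => P) /
        (ε / 2) ^ 2 ≤ 2⁻¹ := by
      rw [div_le_iff₀ (by positivity)]
      refine (variance_empRisk_le P hf hn).trans ?_
      rw [div_le_iff₀ (by positivity)]
      linarith
    refine h.trans ((ENNReal.ofReal_le_ofReal hreal).trans_eq ?_)
    rw [ENNReal.ofReal_inv_of_pos two_pos, ENNReal.ofReal_ofNat]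
  have hcompl : {s : Fin n → X × Bool | |risk P f - empRisk f s| < ε / 2} =
      {s | ε / 2 ≤ |empRisk f s - risk P f|}ᶜ := by
    ext s
    simp [abs_sub_comm]
  rw [hcompl, prob_compl_eq_one_sub hmeas, ← ENNReal.one_sub_inv_two]
  exact tsub_le_tsub_left hcheb 1

lemma measurableSet_lt_iSup_abs_empRisk_sub {F : Set (X → Bool)} (hFc : F.Countable)
    (hFmeas : ∀ f ∈ F, Measurable f) (c : ℝ) :
    MeasurableSet {p : (Fin n → X × Bool) × (Fin n → X × Bool) |
      c < ⨆ f : F, |empRisk (f : X → Bool) p.1 - empRisk (f : X → Bool) p.2|} := by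
  have := hFc.to_subtype
  refine measurableSet_lt measurable_const (Measurable.iSup fun f => ?_)
  have hf := measurable_empRisk (n := n) (hFmeas f f.2)
  exact ((hf.comp measurable_fst).sub (hf.comp measurable_snd)).abs

end Symmetrization

/-- **Symmetrization lemma of Vapnik and Chervonenkis.** Let `F` be a countable class of
classifiers and consider `2n` points drawn i.i.d. from `P`, split into an original sample
(on which the empirical risk is `R_emp`) and a ghost sample (on which it is `R'_emp`).
Then for every `ε > 0` with `n ε² ≥ 2`,
`Pr(sup_{f ∈ F} |R(f) − R_emp(f)| > ε) ≤ 2 Pr(sup_{f ∈ F} |R_emp(f) − R'_emp(f)| > ε/2)`. -/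
theorem symmetrization_lemma {X : Type*} [MeasurableSpace X]
    (P : Measure (X × Bool)) [IsProbabilityMeasure P]
    (F : Set (X → Bool)) (hFc : F.Countable) (hFmeas : ∀ f ∈ F, Measurable f)
    (n : ℕ) (ε : ℝ) (hε : 0 < ε) (hnε : 2 ≤ n * ε ^ 2) :
    ((Measure.pi fun _ : Fin n => P)
        {s | ε < ⨆ f : F, |risk P f - empRisk (f : X → Bool) s|}).toReal
      ≤ 2 * (((Measure.pi fun _ : Fin n => P).prod (Measure.pi fun _ : Fin n => P))
          {p | ε / 2 < ⨆ f : F,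
              |empRisk (f : X → Bool) p.1 - empRisk (f : X → Bool) p.2|}).toReal := by
  set μ := Measure.pi fun _ : Fin n => P
  set B := {p : (Fin n → X × Bool) × (Fin n → X × Bool) | ε / 2 < ⨆ f : F,
    |empRisk (f : X → Bool) p.1 - empRisk (f : X → Bool) p.2|}
  have hB : MeasurableSet B := measurableSet_lt_iSup_abs_empRisk_sub hFc hFmeas _
  have hsub : {s | ε < ⨆ f : F, |risk P f - empRisk (f : X → Bool) s|} ⊆
      {s | 2⁻¹ ≤ μ (Prod.mk s ⁻¹' B)} := by
    intro s hs
    rw [Set.mem_ofPred_eq] at hs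
    have : Nonempty F := by
      by_contra hF
      rw [not_nonempty_iff] at hF
      rw [Real.iSup_of_isEmpty] at hs
      exact hε.not_gt hs
    obtain ⟨f, hf⟩ := exists_lt_of_lt_ciSup hs
    refine (one_half_le_measure_abs_risk_sub_empRisk_lt P (hFmeas f f.2) hε hnε).trans
      (measure_mono fun t ht => ?_)
    have hbdd : BddAbove (Set.range fun g : F =>
        |empRisk (g : X → Bool) s - empRisk (g : X → Bool) t|) :=
      ⟨1, Set.forall_mem_range.2 fun g => abs_empRisk_sub_empRisk_le_one _ s t⟩
    refine lt_of_lt_of_le ?_ (le_ciSup hbdd f)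
    have htri := abs_sub_le (risk P f) (empRisk (f : X → Bool) t) (empRisk (f : X → Bool) s)
    rw [abs_sub_comm (empRisk (f : X → Bool) t)] at htri
    have ht' : |risk P f - empRisk (f : X → Bool) t| < ε / 2 := ht
    linarith
  have hmarkov : 2⁻¹ * μ {s | 2⁻¹ ≤ μ (Prod.mk s ⁻¹' B)} ≤ (μ.prod μ) B := by
    rw [Measure.prod_apply hB]
    exact mul_meas_ge_le_lintegral (measurable_measure_prodMk_left hB) _
  have hle := ENNReal.toReal_mono (measure_ne_top _ _)
    ((mul_le_mul_right (measure_mono hsub) _).trans hmarkov)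
  rw [ENNReal.toReal_mul, ENNReal.toReal_inv, ENNReal.toReal_ofNat] at hle
  linarith
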